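/- arXiv:0907.2561 — 2 statements merged into one kernel-verified Lean document; each statement's English description precedes it below -/
import Mathlib

section
/- Fix J ≥ 0. For Lebesgue-almost every h ∈ ℝ, the fluctuations of the magnetization in the Gibbs state vanish in the thermodynamic limit: lim_{N→∞} ( ω_N(m²) − (ω_N(m))² ) = 0. -/
open Filter MeasureTheory

noncomputable section

/-- The value of a spin encoded by a Boolean: `+1` or `-1`. -/
def spin (b : Bool) : ℝ := if b then 1 else -1

/-- Magnetization of a configuration of `N` spins. -/
def mag (N : ℕ) (σ : Fin N → Bool) : ℝ := (∑ i, spin (σ i)) / N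

/-- Curie-Weiss Hamiltonian. -/
def ham (N : ℕ) (J h : ℝ) (σ : Fin N → Bool) : ℝ :=
  -(N * (J / 2 * mag N σ ^ 2 + h * mag N σ))

/-- Curie-Weiss partition function. -/
def Z (N : ℕ) (J h : ℝ) : ℝ := ∑ σ : Fin N → Bool, Real.exp (-ham N J h σ)

/-- Gibbs expectation of an observable `f`. -/
def gibbs (N : ℕ) (J h : ℝ) (f : (Fin N → Bool) → ℝ) : ℝ :=
  (∑ σ : Fin N → Bool, f σ * Real.exp (-ham N J h σ)) / Z N J h


/-- Total spin. -/
def totS (N : ℕ) (σ : Fin N → Bool) : ℝ := ∑ i, spin (σ i)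

lemma totS_abs (N : ℕ) (σ : Fin N → Bool) : |totS N σ| ≤ N := by
  unfold totS
  calc |∑ i, spin (σ i)| ≤ ∑ i, |spin (σ i)| := Finset.abs_sum_le_sum_abs _ _
    _ ≤ ∑ _i : Fin N, (1 : ℝ) := by
        apply Finset.sum_le_sum
        intro i _
        unfold spin
        split_ifs <;> simp
    _ = N := by simp

lemma totS_zero (σ : Fin 0 → Bool) : totS 0 σ = 0 := by simp [totS]

lemma mul_mag (N : ℕ) (σ : Fin N → Bool) : (N : ℝ) * mag N σ = totS N σ := by
  rcases Nat.eq_zero_or_pos N with h | h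
  · subst h; simp [totS]
  · have : (N : ℝ) ≠ 0 := by positivity
    unfold mag totS
    field_simp

lemma mag_abs (N : ℕ) (σ : Fin N → Bool) : |mag N σ| ≤ 1 := by
  have h := totS_abs N σ
  change |totS N σ / N| ≤ 1
  rw [abs_div, Nat.abs_cast]
  exact div_le_one_of_le₀ h (Nat.cast_nonneg N)

lemma neg_ham (N : ℕ) (J h : ℝ) (σ : Fin N → Bool) :
    -ham N J h σ = J / 2 * (totS N σ ^ 2 / N) + h * totS N σ := by
  rcases Nat.eq_zero_or_pos N with h0 | h0
  · subst h0; simp [totS, ham]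
  · have : (N : ℝ) ≠ 0 := by positivity
    rw [← mul_mag]
    unfold ham
    field_simp

lemma Z_pos (N : ℕ) (J h : ℝ) : 0 < Z N J h :=
  Finset.sum_pos (fun _ _ => Real.exp_pos _) Finset.univ_nonempty

lemma sq_div_sub (m n : ℕ) (a b : ℝ) (ha : |a| ≤ m) (hb : |b| ≤ n) :
    (a + b) ^ 2 / ((m + n : ℕ) : ℝ) ≤ a ^ 2 / m + b ^ 2 / n := by
  rcases Nat.eq_zero_or_pos m with h0 | h0
  · subst h0
    have : a = 0 := by simpa using ha
    simp [this]
  rcases Nat.eq_zero_or_pos n with h1 | h1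
  · subst h1
    have : b = 0 := by simpa using hb
    simp [this]
  have hm : (0 : ℝ) < m := by exact_mod_cast h0
  have hn : (0 : ℝ) < n := by exact_mod_cast h1
  push_cast
  rw [div_add_div _ _ hm.ne' hn.ne', div_le_div_iff₀ (by positivity) (by positivity)]
  nlinarith [sq_nonneg (a * n - b * m)]

lemma totS_append (m n : ℕ) (x : Fin m → Bool) (y : Fin n → Bool) :
    totS (m + n) (Fin.append x y) = totS m x + totS n y := by
  simp [totS, Fin.sum_univ_add]

lemma Z_sub (J : ℝ) (hJ : 0 ≤ J) (h : ℝ) (m n : ℕ) :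
    Z (m + n) J h ≤ Z m J h * Z n J h := by
  unfold Z
  rw [← (Fin.appendEquiv (α := Bool) m n).sum_comp, Fintype.sum_prod_type, Finset.sum_mul_sum]
  refine Finset.sum_le_sum fun x _ => Finset.sum_le_sum fun y _ => ?_
  rw [← Real.exp_add]
  apply Real.exp_le_exp.2
  change -ham (m + n) J h (Fin.append x y) ≤ _
  rw [neg_ham, neg_ham, neg_ham, totS_append]
  have := mul_le_mul_of_nonneg_left
    (sq_div_sub m n _ _ (totS_abs m x) (totS_abs n y)) (by positivity : 0 ≤ J / 2)
  linarith

lemma Z_lower (J : ℝ) (hJ : 0 ≤ J) (h : ℝ) (N : ℕ) :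
    Real.exp (-(N * |h|)) ≤ Z N J h := by
  refine le_trans ?_ (Finset.single_le_sum (f := fun σ : Fin N → Bool => Real.exp (-ham N J h σ))
    (fun _ _ => (Real.exp_pos _).le) (Finset.mem_univ (fun _ => true)))
  apply Real.exp_le_exp.2
  rw [neg_ham]
  have h1 : 0 ≤ J / 2 * (totS N (fun _ => true) ^ 2 / N) := by positivity
  have h2 : |h * totS N (fun _ => true)| ≤ |h| * N := by
    rw [abs_mul]
    exact mul_le_mul_of_nonneg_left (totS_abs _ _) (abs_nonneg _)
  have := (abs_le.1 h2).1
  linarith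

lemma Z_lip (J h k : ℝ) (N : ℕ) : Z N J k ≤ Real.exp (N * |k - h|) * Z N J h := by
  unfold Z
  rw [Finset.mul_sum]
  refine Finset.sum_le_sum fun σ _ => ?_
  rw [← Real.exp_add]
  apply Real.exp_le_exp.2
  rw [neg_ham, neg_ham]
  have h2 : |(k - h) * totS N σ| ≤ |k - h| * N := by
    rw [abs_mul]
    exact mul_le_mul_of_nonneg_left (totS_abs _ _) (abs_nonneg _)
  have := (abs_le.1 h2).2
  linarith

/-- The finite-volume pressure. -/
def press (J : ℝ) (N : ℕ) (h : ℝ) : ℝ := Real.log (Z N J h) / N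

lemma press_lim (J : ℝ) (hJ : 0 ≤ J) (h : ℝ) :
    ∃ l, Tendsto (fun N => press J N h) atTop (nhds l) := by
  have hs : Subadditive (fun N => Real.log (Z N J h)) := by
    intro m n
    rw [← Real.log_mul (Z_pos _ _ _).ne' (Z_pos _ _ _).ne']
    exact Real.log_le_log (Z_pos _ _ _) (Z_sub J hJ h m n)
  refine ⟨_, hs.tendsto_lim ⟨-|h|, ?_⟩⟩
  rintro _ ⟨N, rfl⟩
  rcases Nat.eq_zero_or_pos N with h0 | h0
  · subst h0; simp
  have hN : (0 : ℝ) < N := by exact_mod_cast h0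
  change -|h| ≤ Real.log (Z N J h) / N
  rw [le_div_iff₀ hN, Real.le_log_iff_exp_le (Z_pos _ _ _)]
  refine le_trans (le_of_eq ?_) (Z_lower J hJ h N)
  congr 1; ring

lemma press_lip (J h k : ℝ) (N : ℕ) : press J N k ≤ press J N h + |k - h| := by
  rcases Nat.eq_zero_or_pos N with h0 | h0
  · subst h0; simp [press]
  have hN : (0 : ℝ) < N := by exact_mod_cast h0
  have := Real.log_le_log (Z_pos _ _ _) (Z_lip J h k N)
  rw [Real.log_mul (Real.exp_pos _).ne' (Z_pos _ _ _).ne', Real.log_exp] at this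
  unfold press
  rw [div_add' _ _ _ hN.ne']
  gcongr
  linarith

lemma Z_shift (J h t : ℝ) (N : ℕ) :
    Z N J (h + t) = ∑ σ : Fin N → Bool, Real.exp (t * (N * mag N σ)) * Real.exp (-ham N J h σ) := by
  unfold Z
  refine Finset.sum_congr rfl fun σ _ => ?_
  rw [← Real.exp_add, neg_ham, neg_ham, mul_mag]
  congr 1; ring

lemma exp_press (J h t : ℝ) (N : ℕ) (hN : 0 < N) :
    Z N J (h + t) = Real.exp (N * (press J N (h + t) - press J N h)) * Z N J h := by
  have hN' : (N : ℝ) ≠ 0 := by positivity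
  have : N * (press J N (h + t) - press J N h) = Real.log (Z N J (h+t)) - Real.log (Z N J h) := by
    unfold press; field_simp
  rw [this, Real.exp_sub, Real.exp_log (Z_pos _ _ _), Real.exp_log (Z_pos _ _ _),
    div_mul_cancel₀ _ (Z_pos _ _ _).ne']

lemma var_nonneg_le (J h d : ℝ) (N : ℕ) :
    0 ≤ gibbs N J h (fun σ => mag N σ ^ 2) - gibbs N J h (mag N) ^ 2 ∧
    gibbs N J h (fun σ => mag N σ ^ 2) - gibbs N J h (mag N) ^ 2
      ≤ (∑ σ : Fin N → Bool, (mag N σ - d) ^ 2 * Real.exp (-ham N J h σ)) / Z N J h := by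
  have key : ∀ c : ℝ, (∑ σ : Fin N → Bool, (mag N σ - c) ^ 2 * Real.exp (-ham N J h σ)) / Z N J h
      = gibbs N J h (fun σ => mag N σ ^ 2) - 2 * c * gibbs N J h (mag N) + c ^ 2 := by
    intro c
    have hz := (Z_pos N J h).ne'
    have : ∑ σ : Fin N → Bool, (mag N σ - c) ^ 2 * Real.exp (-ham N J h σ)
        = ∑ σ : Fin N → Bool, mag N σ ^ 2 * Real.exp (-ham N J h σ)
          - 2 * c * ∑ σ : Fin N → Bool, mag N σ * Real.exp (-ham N J h σ) + c ^ 2 * Z N J h := by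
      unfold Z
      rw [Finset.mul_sum, Finset.mul_sum, ← Finset.sum_sub_distrib, ← Finset.sum_add_distrib]
      exact Finset.sum_congr rfl fun σ _ => by ring
    rw [this]
    unfold gibbs
    field_simp
  constructor
  · have h1 := key (gibbs N J h (mag N))
    have h2 : 0 ≤ (∑ σ : Fin N → Bool,
        (mag N σ - gibbs N J h (mag N)) ^ 2 * Real.exp (-ham N J h σ)) / Z N J h :=
      div_nonneg (Finset.sum_nonneg fun σ _ => by positivity) (Z_pos _ _ _).le
    nlinarith
  · rw [key d]
    nlinarith [sq_nonneg (gibbs N J h (mag N) - d)]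

lemma pointwise (m d ε s : ℝ) (hm : |m| ≤ 1) (hs : 0 ≤ s) (hε : 0 ≤ ε) :
    (m - d) ^ 2 ≤ ε ^ 2 + (1 + |d|) ^ 2 *
      (Real.exp (s * (m - d - ε)) + Real.exp (s * (d - ε - m))) := by
  have hC : (m - d) ^ 2 ≤ (1 + |d|) ^ 2 := by
    apply sq_le_sq'
    · have := abs_le.1 hm; have := le_abs_self d; linarith [this]
    · have := abs_le.1 hm; have := neg_abs_le d; linarith [this]
  have e1 := Real.exp_pos (s * (m - d - ε))
  have e2 := Real.exp_pos (s * (d - ε - m))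
  rcases le_or_gt (|m - d|) ε with h | h
  · have : (m - d) ^ 2 ≤ ε ^ 2 := sq_le_sq' (abs_le.1 h).1 (abs_le.1 h).2
    have : 0 ≤ (1 + |d|) ^ 2 *
      (Real.exp (s * (m - d - ε)) + Real.exp (s * (d - ε - m))) := by positivity
    linarith
  · have h1 : 1 ≤ Real.exp (s * (m - d - ε)) + Real.exp (s * (d - ε - m)) := by
      rcases lt_abs.1 h with h | h
      · have : 1 ≤ Real.exp (s * (m - d - ε)) :=
          Real.one_le_exp (mul_nonneg hs (by linarith))
        linarith
      · have : 1 ≤ Real.exp (s * (d - ε - m)) :=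
          Real.one_le_exp (mul_nonneg hs (by linarith))
        linarith
    nlinarith [mul_le_mul_of_nonneg_left h1 (sq_nonneg (1 + |d|)), sq_nonneg ε]

lemma chernoff (J h d ε t : ℝ) (N : ℕ) (hN : 0 < N) (ht : 0 ≤ t) (hε : 0 ≤ ε) :
    (∑ σ : Fin N → Bool, (mag N σ - d) ^ 2 * Real.exp (-ham N J h σ)) / Z N J h
      ≤ ε ^ 2 + (1 + |d|) ^ 2 *
        (Real.exp (N * (press J N (h + t) - press J N h - t * (d + ε)))
        + Real.exp (N * (press J N (h + -t) - press J N h + t * (d - ε)))) := by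
  rw [div_le_iff₀ (Z_pos _ _ _)]
  have e1 : Real.exp (N * (press J N (h + t) - press J N h - t * (d + ε))) * Z N J h
      = Real.exp (-(N * (t * (d + ε)))) * Z N J (h + t) := by
    rw [exp_press J h t N hN, ← mul_assoc, ← Real.exp_add]
    congr 2; ring
  have e2 : Real.exp (N * (press J N (h + -t) - press J N h + t * (d - ε))) * Z N J h
      = Real.exp (N * (t * (d - ε))) * Z N J (h + -t) := by
    rw [exp_press J h (-t) N hN, ← mul_assoc, ← Real.exp_add]
    congr 2; ring
  rw [add_mul, mul_assoc, add_mul (Real.exp _), e1, e2, Z_shift, Z_shift]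
  unfold Z
  rw [Finset.mul_sum, Finset.mul_sum, Finset.mul_sum, ← Finset.sum_add_distrib, Finset.mul_sum,
    ← Finset.sum_add_distrib]
  refine Finset.sum_le_sum fun σ _ => ?_
  have := mul_le_mul_of_nonneg_right
    (pointwise (mag N σ) d ε (N * t) (mag_abs N σ) (by positivity) hε)
    (Real.exp_pos (-ham N J h σ)).le
  refine this.trans (le_of_eq ?_)
  have a1 : Real.exp (N * t * (mag N σ - d - ε))
      = Real.exp (-(N * (t * (d + ε)))) * Real.exp (t * (N * mag N σ)) := by
    rw [← Real.exp_add]; congr 1; ring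
  have a2 : Real.exp (N * t * (d - ε - mag N σ))
      = Real.exp (N * (t * (d - ε))) * Real.exp (-t * (N * mag N σ)) := by
    rw [← Real.exp_add]; congr 1; ring
  rw [a1, a2]; ring

lemma exp_tendsto (f : ℕ → ℝ) (l : ℝ) (hl : l < 0) (hf : Tendsto f atTop (nhds l)) :
    Tendsto (fun N : ℕ => Real.exp (N * f N)) atTop (nhds 0) :=
  Real.tendsto_exp_atBot.comp (tendsto_natCast_atTop_atTop.atTop_mul_neg hl hf)

/-- For fixed `J ≥ 0` and Lebesgue-almost every `h`, the fluctuations of the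
magnetization in the Gibbs state vanish in the thermodynamic limit. -/
theorem curieWeiss_magnetization_selfAveraging (J : ℝ) (hJ : 0 ≤ J) :
    ∀ᵐ h ∂(volume : Measure ℝ),
      Tendsto (fun N : ℕ =>
          gibbs N J h (fun σ => mag N σ ^ 2) - gibbs N J h (mag N) ^ 2)
        atTop (nhds 0) := by
  choose A hA using press_lim J hJ
  have hlip : LipschitzWith 1 A := by
    refine LipschitzWith.of_le_add fun x y => ?_
    rw [Real.dist_eq]
    exact le_of_tendsto_of_tendsto' (hA x) ((hA y).add_const _) fun N => press_lip J y x N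
  filter_upwards [hlip.ae_differentiableAt_real] with h hd
  have hd := hd.hasDerivAt
  set d := deriv A h
  rw [Metric.tendsto_atTop']
  intro η hη
  obtain ⟨ε, hε, hεη⟩ : ∃ ε : ℝ, 0 < ε ∧ ε ^ 2 < η := by
    refine ⟨Real.sqrt (η / 2), Real.sqrt_pos.2 (by linarith), ?_⟩
    rw [Real.sq_sqrt (by linarith)]; linarith
  -- choose `t`
  have hlin := (hasDerivAt_iff_isLittleO_nhds_zero.1 hd).def (half_pos hε)
  obtain ⟨r, hr, hball⟩ := Metric.eventually_nhds_iff.1 hlin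
  set t := r / 2
  have ht : 0 < t := half_pos hr
  have b1 := hball (y := t) (by
    rw [dist_zero_right, Real.norm_eq_abs, abs_of_pos ht]; exact half_lt_self hr)
  have b2 := hball (y := -t) (by
    rw [dist_zero_right, norm_neg, Real.norm_eq_abs, abs_of_pos ht]; exact half_lt_self hr)
  rw [norm_neg] at b2
  simp only [Real.norm_eq_abs, smul_eq_mul, abs_of_pos ht] at b1 b2
  have b1 := (abs_le.1 b1).2
  have b2 := (abs_le.1 b2).2
  have hεt : 0 < ε * t := mul_pos hε ht
  have l1 := exp_tendsto _ _ (by nlinarith : A (h + t) - A h - t * (d + ε) < 0)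
    (((hA (h + t)).sub (hA h)).sub_const (t * (d + ε)))
  have l2 := exp_tendsto _ _ (by nlinarith : A (h + -t) - A h + t * (d - ε) < 0)
    (((hA (h + -t)).sub (hA h)).add_const (t * (d - ε)))
  have l3 := ((l1.add l2).const_mul ((1 + |d|) ^ 2)).const_add (ε ^ 2)
  have l4 := l3.eventually_lt_const (by simpa using hεη)
  obtain ⟨N0, hN0⟩ := eventually_atTop.1 (l4.and (eventually_gt_atTop 0))
  refine ⟨N0, fun N hN => ?_⟩
  obtain ⟨c1, c2⟩ := hN0 N hN.le
  obtain ⟨v1, v2⟩ := var_nonneg_le J h d N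
  rw [Real.dist_eq, sub_zero, abs_of_nonneg v1]
  exact lt_of_le_of_lt (v2.trans (chernoff J h d ε t N c2 ht.le hε.le)) c1
end
end

section
/- Let J ≥ 0 and h ∈ ℝ be such that the function p_up(m̄) = ln 2 − (J/2)·m̄² + ln cosh(J·m̄ + h) attains its supremum over [−1,1] at a unique point m̄*. Then the Gibbs expectation of the magnetization converges to it: lim_{N→∞} ω_N(m) = m̄*. -/
open Filter

noncomputable section

/-- The variational upper-bound functional for the Curie-Weiss pressure. -/
def pUp (J h m : ℝ) : ℝ := Real.log 2 - J / 2 * m ^ 2 + Real.log (Real.cosh (J * m + h))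

/-- Exponential weight linearised at `v`. -/
def linW (N : ℕ) (J h v : ℝ) (σ : Fin N → Bool) : ℝ :=
  Real.exp (N * ((J * v + h) * mag N σ) - N * (J / 2 * v ^ 2))

lemma sum_exp_mag (N : ℕ) (hN : 0 < N) (t : ℝ) :
    ∑ σ : Fin N → Bool, Real.exp (N * (t * mag N σ)) = (2 * Real.cosh t) ^ N := by
  have hN' : (N : ℝ) ≠ 0 := by positivity
  have h1 : ∀ σ : Fin N → Bool,
      Real.exp (N * (t * mag N σ)) = ∏ i, Real.exp (t * spin (σ i)) := by
    intro σ
    rw [← Real.exp_sum, ← Finset.mul_sum]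
    congr 1
    unfold mag
    field_simp
  simp_rw [h1]
  have h2 := Finset.prod_univ_sum (fun _ : Fin N => (Finset.univ : Finset Bool))
    (fun _ b => Real.exp (t * spin b))
  rw [Fintype.piFinset_univ] at h2
  rw [← h2]
  simp only [Fintype.sum_bool, spin, Finset.prod_const, Finset.card_univ, Fintype.card_fin]
  congr 1
  rw [Real.cosh_eq]
  simp
  ring

lemma sum_linW (N : ℕ) (hN : 0 < N) (J h v : ℝ) :
    ∑ σ : Fin N → Bool, linW N J h v σ = Real.exp (N * pUp J h v) := by
  unfold linW pUp
  simp_rw [Real.exp_sub]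
  rw [← Finset.sum_div, sum_exp_mag N hN]
  have hc := Real.cosh_pos (J * v + h)
  have : (N : ℝ) * (Real.log 2 - J / 2 * v ^ 2 + Real.log (Real.cosh (J * v + h)))
      = N * Real.log (2 * Real.cosh (J * v + h)) - N * (J / 2 * v ^ 2) := by
    rw [Real.log_mul two_ne_zero hc.ne']
    ring
  rw [this, Real.exp_sub, Real.exp_nat_mul (Real.log _), Real.exp_log (by positivity)]

lemma linW_le (N : ℕ) (J h v : ℝ) (hJ : 0 ≤ J) (σ : Fin N → Bool) :
    linW N J h v σ ≤ Real.exp (-ham N J h σ) := by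
  unfold linW ham
  apply Real.exp_le_exp.mpr
  have h1 : 0 ≤ (N : ℝ) * (J / 2 * (mag N σ - v) ^ 2) := by positivity
  nlinarith [h1]

lemma linW_self (N : ℕ) (J h : ℝ) (σ : Fin N → Bool) :
    linW N J h (mag N σ) σ = Real.exp (-ham N J h σ) := by
  unfold linW ham
  congr 1
  ring

/-- The possible values of the magnetization. -/
def magVals (N : ℕ) : Finset ℝ :=
  (Finset.range (N + 1)).image (fun k : ℕ => (2 * (k : ℝ) - N) / N)

lemma card_magVals (N : ℕ) : (magVals N).card ≤ N + 1 := by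
  unfold magVals
  exact Finset.card_image_le.trans (by simp)

lemma mag_mem_magVals (N : ℕ) (σ : Fin N → Bool) : mag N σ ∈ magVals N := by
  unfold magVals
  rw [Finset.mem_image]
  refine ⟨(Finset.univ.filter (fun i => σ i = true)).card, ?_, ?_⟩
  · rw [Finset.mem_range, Nat.lt_succ_iff]
    exact (Finset.card_le_univ _).trans (by simp)
  · unfold mag
    congr 1
    have : ∀ i, spin (σ i) = 2 * (if σ i = true then (1 : ℝ) else 0) - 1 := by
      intro i
      unfold spin
      split_ifs <;> norm_num
    simp_rw [this]
    rw [Finset.sum_sub_distrib, ← Finset.mul_sum]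
    simp

lemma magVals_Icc (N : ℕ) (hN : 0 < N) {v : ℝ} (hv : v ∈ magVals N) :
    v ∈ Set.Icc (-1 : ℝ) 1 := by
  unfold magVals at hv
  rw [Finset.mem_image] at hv
  obtain ⟨k, hk, rfl⟩ := hv
  have hN' : (0 : ℝ) < N := by exact_mod_cast hN
  have hk' : (k : ℝ) ≤ N := by
    exact_mod_cast Nat.lt_succ_iff.mp (Finset.mem_range.mp hk)
  have hk0 : (0 : ℝ) ≤ k := by positivity
  constructor
  · rw [le_div_iff₀ hN']; linarith
  · rw [div_le_iff₀ hN']; linarith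

lemma exists_gap (J h mstar : ℝ)
    (hmax : ∀ x ∈ Set.Icc (-1 : ℝ) 1, pUp J h x ≤ pUp J h mstar)
    (huniq : ∀ x ∈ Set.Icc (-1 : ℝ) 1,
      (∀ y ∈ Set.Icc (-1 : ℝ) 1, pUp J h y ≤ pUp J h x) → x = mstar)
    (ε : ℝ) (hε : 0 < ε) :
    ∃ δ > 0, ∀ x ∈ Set.Icc (-1 : ℝ) 1, ε ≤ |x - mstar| → pUp J h x ≤ pUp J h mstar - δ := by
  have hcont : Continuous (pUp J h) := by
    unfold pUp
    have : Continuous (fun m : ℝ => Real.log (Real.cosh (J * m + h))) :=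
      Continuous.log (Real.continuous_cosh.comp (by fun_prop))
        (fun x => (Real.cosh_pos _).ne')
    fun_prop
  have hK : IsCompact (Set.Icc (-1 : ℝ) 1 ∩ {x | ε ≤ |x - mstar|}) :=
    isCompact_Icc.inter_right (isClosed_le continuous_const (by fun_prop))
  rcases (Set.Icc (-1 : ℝ) 1 ∩ {x | ε ≤ |x - mstar|}).eq_empty_or_nonempty with he | hne
  · refine ⟨1, one_pos, fun x hx hx' => ?_⟩
    have : x ∈ (Set.Icc (-1 : ℝ) 1 ∩ {x | ε ≤ |x - mstar|}) := ⟨hx, hx'⟩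
    rw [he] at this
    exact this.elim
  · obtain ⟨x0, hx0, hx0m⟩ := hK.exists_isMaxOn hne hcont.continuousOn
    have hlt : pUp J h x0 < pUp J h mstar := by
      by_contra hcon
      have := huniq x0 hx0.1 (fun y hy => (hmax y hy).trans (not_lt.mp hcon))
      have h2 : ε ≤ |x0 - mstar| := hx0.2
      rw [this] at h2
      simp at h2
      linarith
    refine ⟨pUp J h mstar - pUp J h x0, by linarith, fun x hx hx' => ?_⟩
    have : pUp J h x ≤ pUp J h x0 := hx0m ⟨hx, hx'⟩
    linarith

lemma gibbs_bound (J h : ℝ) (hJ : 0 ≤ J) (mstar : ℝ)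
    (hmem : mstar ∈ Set.Icc (-1 : ℝ) 1) (ε δ : ℝ) (hε : 0 < ε)
    (hδ : ∀ x ∈ Set.Icc (-1 : ℝ) 1, ε ≤ |x - mstar| → pUp J h x ≤ pUp J h mstar - δ)
    (N : ℕ) (hN : 0 < N) :
    |gibbs N J h (mag N) - mstar| ≤ ε + 2 * ((N + 1) * Real.exp (-δ * N)) := by
  have hZ : Real.exp (N * pUp J h mstar) ≤ Z N J h := by
    rw [← sum_linW N hN]
    exact Finset.sum_le_sum (fun σ _ => linW_le N J h mstar hJ σ)
  have hZpos : 0 < Z N J h := (Real.exp_pos _).trans_le hZ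
  have h1 : gibbs N J h (mag N) - mstar
      = (∑ σ : Fin N → Bool, (mag N σ - mstar) * Real.exp (-ham N J h σ)) / Z N J h := by
    unfold gibbs
    simp_rw [sub_mul]
    rw [Finset.sum_sub_distrib, ← Finset.mul_sum, sub_div]
    congr 1
    rw [eq_div_iff hZpos.ne']
    rfl
  rw [h1, abs_div, abs_of_pos hZpos, div_le_iff₀ hZpos]
  set V := (magVals N).filter (fun v => ε ≤ |v - mstar|) with hV
  have h2 : ∀ σ : Fin N → Bool, |(mag N σ - mstar) * Real.exp (-ham N J h σ)|
      ≤ ε * Real.exp (-ham N J h σ) + 2 * ∑ v ∈ V, linW N J h v σ := by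
    intro σ
    rw [abs_mul, Real.abs_exp]
    have hnn : ∀ v ∈ V, 0 ≤ linW N J h v σ := fun v _ => (Real.exp_pos _).le
    have hw := Real.exp_pos (-ham N J h σ)
    rcases lt_or_ge |mag N σ - mstar| ε with hlt | hge
    · have := Finset.sum_nonneg hnn
      nlinarith
    · have hmV : mag N σ ∈ V := by
        rw [hV, Finset.mem_filter]
        exact ⟨mag_mem_magVals N σ, hge⟩
      have h3 := Finset.single_le_sum hnn hmV
      rw [linW_self] at h3
      have h4 := magVals_Icc N hN (mag_mem_magVals N σ)
      have h5 : |mag N σ - mstar| ≤ 2 := by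
        rw [abs_le]
        constructor <;> linarith [h4.1, h4.2, hmem.1, hmem.2]
      nlinarith
  have h6 : ∑ σ : Fin N → Bool, ∑ v ∈ V, linW N J h v σ
      ≤ (N + 1) * Real.exp (-δ * N) * Z N J h := by
    rw [Finset.sum_comm]
    have h7 : ∀ v ∈ V, ∑ σ : Fin N → Bool, linW N J h v σ
        ≤ Real.exp (-δ * N) * Z N J h := by
      intro v hv
      rw [hV, Finset.mem_filter] at hv
      rw [sum_linW N hN]
      have h8 := hδ v (magVals_Icc N hN hv.1) hv.2
      calc Real.exp (N * pUp J h v) ≤ Real.exp (-δ * N + N * pUp J h mstar) := by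
            apply Real.exp_le_exp.mpr
            have : (0 : ℝ) ≤ N := by positivity
            nlinarith
        _ = Real.exp (-δ * N) * Real.exp (N * pUp J h mstar) := Real.exp_add _ _
        _ ≤ _ := mul_le_mul_of_nonneg_left hZ (Real.exp_pos _).le
    refine (Finset.sum_le_card_nsmul V _ _ h7).trans ?_
    rw [nsmul_eq_mul, mul_assoc]
    apply mul_le_mul_of_nonneg_right
    · have : V.card ≤ N + 1 := (Finset.card_filter_le _ _).trans (card_magVals N)
      exact_mod_cast this
    · positivity
  calc |∑ σ : Fin N → Bool, (mag N σ - mstar) * Real.exp (-ham N J h σ)|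
      ≤ ∑ σ : Fin N → Bool, |(mag N σ - mstar) * Real.exp (-ham N J h σ)| :=
        Finset.abs_sum_le_sum_abs _ _
    _ ≤ ∑ σ : Fin N → Bool,
        (ε * Real.exp (-ham N J h σ) + 2 * ∑ v ∈ V, linW N J h v σ) :=
        Finset.sum_le_sum (fun σ _ => h2 σ)
    _ = ε * Z N J h + 2 * ∑ σ : Fin N → Bool, ∑ v ∈ V, linW N J h v σ := by
        rw [Finset.sum_add_distrib, ← Finset.mul_sum, ← Finset.mul_sum]
        rfl
    _ ≤ _ := by linarith

lemma tendsto_err (δ : ℝ) (hδ : 0 < δ) :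
    Tendsto (fun N : ℕ => 2 * (((N : ℝ) + 1) * Real.exp (-δ * N))) atTop (nhds 0) := by
  have h0 := (tendsto_rpow_mul_exp_neg_mul_atTop_nhds_zero 0 δ hδ).comp
    (tendsto_natCast_atTop_atTop (R := ℝ))
  have h1 := (tendsto_rpow_mul_exp_neg_mul_atTop_nhds_zero 1 δ hδ).comp
    (tendsto_natCast_atTop_atTop (R := ℝ))
  have h2 := (h1.add h0).const_mul 2
  simp only [add_zero, mul_zero] at h2
  refine h2.congr (fun N => ?_)
  simp
  ring

/-- If `p_up` attains its supremum over `[−1,1]` at a unique point `m̄*`, then the Gibbs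
expectation of the magnetization converges to `m̄*` in the thermodynamic limit. -/
theorem curieWeiss_magnetization_tendsto_maximizer (J h : ℝ) (hJ : 0 ≤ J) (mstar : ℝ)
    (hmem : mstar ∈ Set.Icc (-1 : ℝ) 1)
    (hmax : ∀ x ∈ Set.Icc (-1 : ℝ) 1, pUp J h x ≤ pUp J h mstar)
    (huniq : ∀ x ∈ Set.Icc (-1 : ℝ) 1,
      (∀ y ∈ Set.Icc (-1 : ℝ) 1, pUp J h y ≤ pUp J h x) → x = mstar) :
    Tendsto (fun N : ℕ => gibbs N J h (mag N)) atTop (nhds mstar) := by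
  rw [Metric.tendsto_atTop]
  intro ε hε
  obtain ⟨δ, hδ, hgap⟩ := exists_gap J h mstar hmax huniq (ε / 2) (by positivity)
  obtain ⟨N0, hN0⟩ := (Metric.tendsto_atTop.mp (tendsto_err δ hδ)) (ε / 2) (by positivity)
  refine ⟨N0 + 1, fun N hN => ?_⟩
  have h1 := gibbs_bound J h hJ mstar hmem (ε / 2) δ (by positivity) hgap N (by omega)
  have h2 := hN0 N (by omega)
  rw [Real.dist_eq, sub_zero] at h2
  rw [Real.dist_eq]
  linarith [le_abs_self (2 * (((N : ℝ) + 1) * Real.exp (-δ * N)))]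
end
end
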